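/- For circulants A = circ(a), B = circ(b), C = circ(c) over 𝔽₂, one has dim_{𝔽₂}(ker A ∩ ker B ∩ ker C) = dim_{𝔽₂}(ker Aᵀ ∩ ker Bᵀ ∩ ker Cᵀ) (intersections inside 𝔽₂^G). Consequently rank(H_X) = N − dim_{𝔽₂}(ker A ∩ ker B ∩ ker C), where H_X = [A B C]. -/

import Mathlib

open Matrix

/-- `H_X = [A B C]`, an `N × 3N` matrix with columns indexed by `Fin 3 × G`,
where `A = circ(a)`, `B = circ(b)`, `C = circ(c)`. -/
def TT_HX {G : Type*} [AddCommGroup G] (a b c : G → ZMod 2) :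
    Matrix G (Fin 3 × G) (ZMod 2) :=
  Matrix.of fun g p =>
    ![Matrix.circulant a, Matrix.circulant b, Matrix.circulant c] p.1 g p.2

theorem circ_flip {G : Type*} [AddCommGroup G] [Fintype G] (a v : G → ZMod 2) (i : G) :
    ((Matrix.circulant a)ᵀ *ᵥ (fun g => v (-g))) i = ((Matrix.circulant a) *ᵥ v) (-i) := by
  simp only [Matrix.mulVec, dotProduct, Matrix.transpose_apply, Matrix.circulant_apply]
  refine Fintype.sum_equiv (Equiv.neg G) _ _ fun j => ?_
  simp only [Equiv.neg_apply]
  congr 2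
  abel

theorem circ_flip_ker {G : Type*} [AddCommGroup G] [Fintype G] (a v : G → ZMod 2) :
    (Matrix.circulant a)ᵀ *ᵥ (fun g => v (-g)) = 0 ↔ (Matrix.circulant a) *ᵥ v = 0 := by
  constructor
  · intro h
    ext i
    have := circ_flip a v (-i)
    rw [h, neg_neg] at this
    exact this.symm
  · intro h
    ext i
    rw [circ_flip, h]
    rfl

theorem tt_HX_transpose_mulVec {G : Type*} [AddCommGroup G] [Fintype G]
    (a b c v : G → ZMod 2) :
    (TT_HX a b c)ᵀ *ᵥ v = 0 ↔ ((Matrix.circulant a)ᵀ *ᵥ v = 0 ∧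
      (Matrix.circulant b)ᵀ *ᵥ v = 0) ∧ (Matrix.circulant c)ᵀ *ᵥ v = 0 := by
  constructor
  · intro h
    exact ⟨⟨funext fun g => congrFun h (0, g), funext fun g => congrFun h (1, g)⟩,
      funext fun g => congrFun h (2, g)⟩
  · rintro ⟨⟨h0, h1⟩, h2⟩
    ext ⟨k, g⟩
    fin_cases k
    · exact congrFun h0 g
    · exact congrFun h1 g
    · exact congrFun h2 g

/-- `dim(ker A ∩ ker B ∩ ker C) = dim(ker Aᵀ ∩ ker Bᵀ ∩ ker Cᵀ)`, and consequently
`rank(H_X) = N − dim(ker A ∩ ker B ∩ ker C)`. -/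
theorem tt_rank_HX {G : Type*} [AddCommGroup G] [Fintype G] [DecidableEq G]
    (a b c : G → ZMod 2) :
    Module.finrank (ZMod 2)
        ↥(LinearMap.ker (Matrix.circulant a).mulVecLin ⊓
            LinearMap.ker (Matrix.circulant b).mulVecLin ⊓
            LinearMap.ker (Matrix.circulant c).mulVecLin) =
      Module.finrank (ZMod 2)
        ↥(LinearMap.ker (Matrix.circulant a)ᵀ.mulVecLin ⊓
            LinearMap.ker (Matrix.circulant b)ᵀ.mulVecLin ⊓
            LinearMap.ker (Matrix.circulant c)ᵀ.mulVecLin) ∧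
    (TT_HX a b c).rank =
      Fintype.card G -
        Module.finrank (ZMod 2)
          ↥(LinearMap.ker (Matrix.circulant a).mulVecLin ⊓
              LinearMap.ker (Matrix.circulant b).mulVecLin ⊓
              LinearMap.ker (Matrix.circulant c).mulVecLin) := by
  have key : Module.finrank (ZMod 2)
        ↥(LinearMap.ker (Matrix.circulant a).mulVecLin ⊓
            LinearMap.ker (Matrix.circulant b).mulVecLin ⊓
            LinearMap.ker (Matrix.circulant c).mulVecLin) =
      Module.finrank (ZMod 2)
        ↥(LinearMap.ker (Matrix.circulant a)ᵀ.mulVecLin ⊓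
            LinearMap.ker (Matrix.circulant b)ᵀ.mulVecLin ⊓
            LinearMap.ker (Matrix.circulant c)ᵀ.mulVecLin) := by
    let e : (G → ZMod 2) ≃ₗ[ZMod 2] (G → ZMod 2) :=
      LinearEquiv.funCongrLeft (ZMod 2) (ZMod 2) (Equiv.neg G)
    have he : ∀ v, e v = fun g => v (-g) := fun v => rfl
    have hm : Submodule.map (e : (G → ZMod 2) →ₗ[ZMod 2] (G → ZMod 2))
        (LinearMap.ker (Matrix.circulant a).mulVecLin ⊓
            LinearMap.ker (Matrix.circulant b).mulVecLin ⊓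
            LinearMap.ker (Matrix.circulant c).mulVecLin) =
        LinearMap.ker (Matrix.circulant a)ᵀ.mulVecLin ⊓
            LinearMap.ker (Matrix.circulant b)ᵀ.mulVecLin ⊓
            LinearMap.ker (Matrix.circulant c)ᵀ.mulVecLin := by
      ext w
      obtain ⟨v, rfl⟩ := e.surjective w
      rw [Submodule.mem_map_equiv, LinearEquiv.symm_apply_apply, he]
      simp only [Submodule.mem_inf, LinearMap.mem_ker, Matrix.mulVecLin_apply, circ_flip_ker]
    rw [← LinearEquiv.finrank_map_eq e, hm]
  refine ⟨key, ?_⟩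
  have hk : LinearMap.ker (TT_HX a b c)ᵀ.mulVecLin =
      LinearMap.ker (Matrix.circulant a)ᵀ.mulVecLin ⊓
            LinearMap.ker (Matrix.circulant b)ᵀ.mulVecLin ⊓
            LinearMap.ker (Matrix.circulant c)ᵀ.mulVecLin := by
    ext v
    exact tt_HX_transpose_mulVec a b c v
  have hr := LinearMap.finrank_range_add_finrank_ker (TT_HX a b c)ᵀ.mulVecLin
  rw [hk, ← key, Module.finrank_fintype_fun_eq_card] at hr
  rw [← Matrix.rank_transpose, Matrix.rank]
  exact Nat.eq_sub_of_add_eq hr
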